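/- (Theorem 2) Let Z be an additional random variable with values in a finite set 𝒵, and let 𝐒 be a random subset of {1,…,d} such that for every s ⊆ {1,…,d}, value x_s, and value z with P(𝐒 = s, X_s = x_s, Z = z) > 0, the conditional distribution of (X_1,…,X_d, Y) given {𝐒 = s, X_s = x_s, Z = z} equals its conditional distribution given {X_s = x_s, Z = z}. Define f*(s, x_s, z) = p(·|x_s, z) and v*_i(s, x_s, z) = I(Y; X_i | X_s = x_s, Z = z). Then: (i) for every predictor f assigning to each triple (s, x_s, z) a probability mass function on 𝒴 (with the convention −log 0 = +∞), E[ℓ(f(𝐒, X_𝐒, Z), Y)] ≥ E[ℓ(f*(𝐒, X_𝐒, Z), Y)]; and (ii) for every value function v assigning to each triple (s, x_s, z) a vector in ℝ^d, E[(1/d) ∑_{i=1}^d (v_i(𝐒, X_𝐒, Z) − Δ_i)²] ≥ E[(1/d) ∑_{i=1}^d (v*_i(𝐒, X_𝐒, Z) − Δ_i)²], where Δ_i = ℓ(f*(𝐒, X_𝐒, Z), Y) − ℓ(f*(𝐒 ∪ {i}, X_{𝐒∪{i}}, Z), Y). -/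

import Mathlib

open MeasureTheory ProbabilityTheory
open scoped ENNReal NNReal

noncomputable section

variable {Ω : Type}

/-- Conditional probability of `B` given `A`, as a real number. -/
def cpr [MeasureSpace Ω] (A B : Set Ω) : ℝ :=
  (((ℙ : Measure Ω)[|A]) B).toReal

/-- Conditional expectation of `g` given the event `A`. -/
def cexp [MeasureSpace Ω] (A : Set Ω) (g : Ω → ℝ) : ℝ :=
  ∫ ω, g ω ∂((ℙ : Measure Ω)[|A])

/-- Conditional variance of `g` given the event `A`. -/
def cvar [MeasureSpace Ω] (A : Set Ω) (g : Ω → ℝ) : ℝ :=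
  variance g ((ℙ : Measure Ω)[|A])

/-- Conditional pmf of `Y` given the event `A`. -/
def cpmf {𝒴 : Type} [MeasureSpace Ω] (Y : Ω → 𝒴) (A : Set Ω) (y : 𝒴) : ℝ :=
  cpr A {ω | Y ω = y}

/-- Cross-entropy loss `ℓ(q, y) = -log q(y)`. -/
def xent {𝒴 : Type} (q : 𝒴 → ℝ) (y : 𝒴) : ℝ := -Real.log (q y)

/-- `q` is a probability mass function on the finite type `𝒴`. -/
def IsPMF {𝒴 : Type} [Fintype 𝒴] (q : 𝒴 → ℝ) : Prop :=
  (∀ y, 0 ≤ q y) ∧ ∑ y, q y = 1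

/-- Conditional entropy `H(Y | A)` of the finitely-valued `Y` on the event `A`. -/
def entropyOn {𝒴 : Type} [MeasureSpace Ω] [Fintype 𝒴] (Y : Ω → 𝒴) (A : Set Ω) : ℝ :=
  -∑ y, cpmf Y A y * Real.log (cpmf Y A y)

/-- Kullback–Leibler divergence between pmfs on a finite type. -/
def klDivFin {𝒴 : Type} [Fintype 𝒴] (p q : 𝒴 → ℝ) : ℝ :=
  ∑ y, p y * Real.log (p y / q y)

/-- Conditional mutual information `I(Y; Xi | A)` on the event `A`. -/
def cmi {𝒴 𝒳i : Type} [MeasureSpace Ω] [Fintype 𝒴] [Fintype 𝒳i]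
    (Y : Ω → 𝒴) (Xi : Ω → 𝒳i) (A : Set Ω) : ℝ :=
  entropyOn Y A - ∑ xi, cpr A {ω | Xi ω = xi} * entropyOn Y (A ∩ {ω | Xi ω = xi})

/-- The event `X_S = x_S`. -/
def evS {d : ℕ} {𝒳 : Fin d → Type} (X : ∀ i, Ω → 𝒳 i) (S : Finset (Fin d))
    (x : ∀ i, 𝒳 i) : Set Ω :=
  {ω | ∀ i ∈ S, X i ω = x i}

/-- `-log t` valued in `[0, ∞]`, with the convention `-log 0 = +∞`. -/
def negLog (t : ℝ) : ℝ≥0∞ := if t = 0 then ⊤ else ENNReal.ofReal (-Real.log t)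

/-- Gibbs' inequality: the cross entropy of two probability mass functions is minimal when they
agree. -/
theorem sum_mul_log_le_sum_mul_log {𝒴 : Type} [Fintype 𝒴] {p q : 𝒴 → ℝ} (hp : IsPMF p)
    (hq : IsPMF q) (hpq : ∀ y, q y = 0 → p y = 0) :
    ∑ y, p y * Real.log (q y) ≤ ∑ y, p y * Real.log (p y) := by
  have key : ∀ y, p y * Real.log (q y) - p y * Real.log (p y) ≤ q y - p y := by
    intro y
    rcases (hp.1 y).eq_or_lt with h0 | hpos
    · simpa [← h0] using hq.1 y
    · have hqpos : 0 < q y := (hq.1 y).lt_of_ne fun h => hpos.ne' (hpq y h.symm)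
      have h := mul_le_mul_of_nonneg_left
        (Real.log_le_sub_one_of_pos (div_pos hqpos hpos)) hpos.le
      rw [Real.log_div hqpos.ne' hpos.ne', mul_sub, mul_sub, mul_one,
        mul_div_cancel₀ _ hpos.ne'] at h
      exact h
  have h := Finset.sum_le_sum fun y (_ : y ∈ Finset.univ) => key y
  rw [Finset.sum_sub_distrib, Finset.sum_sub_distrib, hp.2, hq.2] at h
  linarith

theorem IsPMF.le_one {𝒴 : Type} [Fintype 𝒴] {q : 𝒴 → ℝ} (hq : IsPMF q) (y : 𝒴) : q y ≤ 1 :=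
  hq.2 ▸ Finset.single_le_sum (fun y _ => hq.1 y) (Finset.mem_univ y)

theorem sum_negLog_mul_eq_ofReal {𝒴 : Type} [Fintype 𝒴] {p q : 𝒴 → ℝ} (hp : IsPMF p)
    (hq : IsPMF q) (hpq : ∀ y, q y = 0 → p y = 0) :
    ∑ y, negLog (q y) * ENNReal.ofReal (p y)
      = ENNReal.ofReal (-∑ y, p y * Real.log (q y)) := by
  have hlog (y : 𝒴) : 0 ≤ -Real.log (q y) :=
    neg_nonneg.2 (Real.log_nonpos (hq.1 y) (hq.le_one y))
  rw [← Finset.sum_neg_distrib, ENNReal.ofReal_sum_of_nonneg fun y _ => by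
    rw [← mul_neg]; exact mul_nonneg (hp.1 y) (hlog y)]
  refine Finset.sum_congr rfl fun y _ => ?_
  by_cases hy : q y = 0
  · simp [hpq y hy]
  · rw [negLog, if_neg hy, ← ENNReal.ofReal_mul (hlog y), mul_comm, mul_neg]

/-- Gibbs' inequality with values in `[0, ∞]`. -/
theorem sum_negLog_mul_le {𝒴 : Type} [Fintype 𝒴] {p q : 𝒴 → ℝ} (hp : IsPMF p)
    (hq : IsPMF q) :
    ∑ y, negLog (p y) * ENNReal.ofReal (p y) ≤ ∑ y, negLog (q y) * ENNReal.ofReal (p y) := by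
  by_cases hpq : ∀ y, q y = 0 → p y = 0
  · rw [sum_negLog_mul_eq_ofReal hp hp fun _ => id, sum_negLog_mul_eq_ofReal hp hq hpq]
    exact ENNReal.ofReal_le_ofReal (neg_le_neg (sum_mul_log_le_sum_mul_log hp hq hpq))
  · push Not at hpq
    obtain ⟨y, hy, hpy⟩ := hpq
    have hpos : 0 < p y := (hp.1 y).lt_of_ne' hpy
    refine le_top.trans ((top_le_iff.2 ?_).trans
      (Finset.single_le_sum (fun _ _ => zero_le) (Finset.mem_univ y)))
    rw [hy, negLog, if_pos rfl, ENNReal.top_mul (ENNReal.ofReal_pos.2 hpos).ne']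

theorem isPMF_measureReal {𝒴 : Type} [Fintype 𝒴] [MeasurableSpace 𝒴]
    [MeasurableSingletonClass 𝒴] [MeasurableSpace Ω] {μ : Measure Ω} [IsProbabilityMeasure μ]
    {Y : Ω → 𝒴} (hY : Measurable Y) : IsPMF fun y => μ.real {ω | Y ω = y} := by
  refine ⟨fun y => measureReal_nonneg, ?_⟩
  have := Measure.isProbabilityMeasure_map (μ := μ) hY.aemeasurable
  have h := sum_measureReal_singleton (μ := μ.map Y) Finset.univ
  simp only [Finset.coe_univ, probReal_univ,
    map_measureReal_apply hY (measurableSet_singleton _)] at h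
  exact h

/-- The true mass function of `Y` minimizes the expected cross-entropy loss. -/
theorem lintegral_negLog_measureReal_le {𝒴 : Type} [Fintype 𝒴] [MeasurableSpace 𝒴]
    [MeasurableSingletonClass 𝒴] [MeasurableSpace Ω] {μ : Measure Ω} [IsProbabilityMeasure μ]
    {Y : Ω → 𝒴} (hY : Measurable Y) {q : 𝒴 → ℝ} (hq : IsPMF q) :
    ∫⁻ ω, negLog (μ.real {ω' | Y ω' = Y ω}) ∂μ ≤ ∫⁻ ω, negLog (q (Y ω)) ∂μ := by
  have hsum (g : 𝒴 → ℝ≥0∞) :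
      ∫⁻ ω, g (Y ω) ∂μ = ∑ y, g y * ENNReal.ofReal (μ.real {ω | Y ω = y}) := by
    rw [← lintegral_map (measurable_of_finite g) hY, lintegral_fintype]
    refine Finset.sum_congr rfl fun y _ => ?_
    rw [Measure.map_apply hY (measurableSet_singleton y), ofReal_measureReal]
    rfl
  rw [hsum fun y => negLog (μ.real {ω' | Y ω' = y}), hsum fun y => negLog (q y)]
  exact sum_negLog_mul_le (isPMF_measureReal hY) hq

/-- The mean is the constant closest to a random variable in mean square. -/
theorem integral_mean_sub_sq_le [MeasurableSpace Ω] {μ : Measure Ω} [IsProbabilityMeasure μ]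
    {D : Ω → ℝ} (hD : MemLp D 2 μ) (c : ℝ) :
    ∫ ω, (μ[D] - D ω) ^ 2 ∂μ ≤ ∫ ω, (c - D ω) ^ 2 ∂μ := by
  have hint : Integrable D μ := hD.integrable one_le_two
  have hsq (a : ℝ) : Integrable (fun ω => (a - D ω) ^ 2) μ :=
    ((memLp_const a).sub hD).integrable_sq
  have hlin : Integrable (fun ω => 2 * (c - μ[D]) * (μ[D] - D ω)) μ :=
    ((integrable_const _).sub hint).const_mul _
  have h0 : ∫ ω, 2 * (c - μ[D]) * (μ[D] - D ω) ∂μ = 0 := by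
    rw [integral_const_mul, integral_sub (integrable_const _) hint]
    simp
  calc ∫ ω, (μ[D] - D ω) ^ 2 ∂μ
      ≤ ∫ ω, ((c - D ω) ^ 2 - 2 * (c - μ[D]) * (μ[D] - D ω)) ∂μ := by
        refine integral_mono (hsq _) ((hsq c).sub hlin) fun ω => ?_
        nlinarith [sq_nonneg (c - μ[D])]
    _ = ∫ ω, (c - D ω) ^ 2 ∂μ := by rw [integral_sub (hsq c) hlin, h0, sub_zero]

/-- Conditionally on each value of the finitely-valued `V` comparing integrals suffices. -/
theorem lintegral_le_of_cond_fiber {ι : Type} [Fintype ι] [MeasurableSpace ι]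
    [DiscreteMeasurableSpace ι] [MeasurableSpace Ω] {μ : Measure Ω} [IsFiniteMeasure μ]
    {V : Ω → ι} (hV : Measurable V) {f g : Ω → ℝ≥0∞}
    (h : ∀ ω, μ (V ⁻¹' {V ω}) ≠ 0 →
      ∫⁻ ω', f ω' ∂μ[|V ⁻¹' {V ω}] ≤ ∫⁻ ω', g ω' ∂μ[|V ⁻¹' {V ω}]) :
    ∫⁻ ω, f ω ∂μ ≤ ∫⁻ ω, g ω ∂μ := by
  rw [← sum_meas_smul_cond_fiber hV μ]
  simp only [lintegral_finsetSum_measure, lintegral_smul_measure]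
  refine Finset.sum_le_sum fun v _ => ?_
  by_cases hv : μ (V ⁻¹' {v}) = 0
  · simp [hv]
  · obtain ⟨ω, rfl⟩ := nonempty_of_measure_ne_zero hv
    exact mul_le_mul_right (h ω hv) _

/-- Conditionally on each value of the finitely-valued `V` comparing integrals suffices. -/
theorem integral_le_of_cond_fiber {ι : Type} [Fintype ι] [MeasurableSpace ι]
    [DiscreteMeasurableSpace ι] [MeasurableSpace Ω] {μ : Measure Ω} [IsFiniteMeasure μ]
    {V : Ω → ι} (hV : Measurable V) {f g : Ω → ℝ}
    (h : ∀ ω, μ (V ⁻¹' {V ω}) ≠ 0 →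
      Integrable f (μ[|V ⁻¹' {V ω}]) ∧ Integrable g (μ[|V ⁻¹' {V ω}]) ∧
      ∫ ω', f ω' ∂μ[|V ⁻¹' {V ω}] ≤ ∫ ω', g ω' ∂μ[|V ⁻¹' {V ω}]) :
    ∫ ω, f ω ∂μ ≤ ∫ ω, g ω ∂μ := by
  have h' (v : ι) : Integrable f (μ (V ⁻¹' {v}) • μ[|V ⁻¹' {v}]) ∧
      Integrable g (μ (V ⁻¹' {v}) • μ[|V ⁻¹' {v}]) ∧
      ∫ ω', f ω' ∂(μ (V ⁻¹' {v}) • μ[|V ⁻¹' {v}])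
        ≤ ∫ ω', g ω' ∂(μ (V ⁻¹' {v}) • μ[|V ⁻¹' {v}]) := by
    by_cases hv : μ (V ⁻¹' {v}) = 0
    · simp [hv]
    · obtain ⟨ω, rfl⟩ := nonempty_of_measure_ne_zero hv
      obtain ⟨hf, hg, hle⟩ := h ω hv
      refine ⟨hf.smul_measure (measure_ne_top _ _), hg.smul_measure (measure_ne_top _ _), ?_⟩
      rw [integral_smul_measure, integral_smul_measure]
      exact smul_le_smul_of_nonneg_left hle ENNReal.toReal_nonneg
  rw [← sum_meas_smul_cond_fiber hV μ, integral_finsetSum_measure fun v _ => (h' v).1,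
    integral_finsetSum_measure fun v _ => (h' v).2.1]
  exact Finset.sum_le_sum fun v _ => (h' v).2.2

/-- The conditional mutual information is the expected drop of the Bayes classifier's loss when
`Xi` is revealed. -/
theorem integral_xent_sub_eq_cmi [MeasureSpace Ω] [IsProbabilityMeasure (ℙ : Measure Ω)]
    {𝒴 𝒳i : Type} [Fintype 𝒴] [MeasurableSpace 𝒴] [MeasurableSingletonClass 𝒴]
    [Fintype 𝒳i] [MeasurableSpace 𝒳i] [MeasurableSingletonClass 𝒳i]
    {Y : Ω → 𝒴} {Xi : Ω → 𝒳i} (hY : Measurable Y) (hXi : Measurable Xi)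
    {A : Set Ω} (hA : MeasurableSet A) (hA0 : (ℙ : Measure Ω) A ≠ 0) :
    ∫ ω, (xent (cpmf Y A) (Y ω) - xent (cpmf Y (A ∩ {ω' | Xi ω' = Xi ω})) (Y ω))
      ∂((ℙ : Measure Ω)[|A]) = cmi Y Xi A := by
  have := cond_isProbabilityMeasure hA0
  have hXY : Measurable fun ω => (Xi ω, Y ω) := hXi.prodMk hY
  have hprob := Measure.isProbabilityMeasure_map (μ := (ℙ : Measure Ω)[|A]) hXY.aemeasurable
  have hset (a : 𝒳i) : MeasurableSet {ω | Xi ω = a} := hXi (measurableSet_singleton a)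
  have hIntY (g : 𝒴 → ℝ) : ∫ ω, g (Y ω) ∂((ℙ : Measure Ω)[|A]) = ∑ y, cpmf Y A y * g y := by
    have := Measure.isProbabilityMeasure_map (μ := (ℙ : Measure Ω)[|A]) hY.aemeasurable
    rw [← integral_map hY.aemeasurable (measurable_of_finite g).aestronglyMeasurable,
      integral_fintype .of_finite]
    refine Finset.sum_congr rfl fun y _ => ?_
    rw [map_measureReal_apply hY (measurableSet_singleton y)]
    rfl
  have hIntXY (g : 𝒳i → 𝒴 → ℝ) : ∫ ω, g (Xi ω) (Y ω) ∂((ℙ : Measure Ω)[|A])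
      = ∑ a, cpr A {ω | Xi ω = a} * ∑ y, cpmf Y (A ∩ {ω | Xi ω = a}) y * g a y := by
    rw [← integral_map hXY.aemeasurable (f := fun p => g p.1 p.2)
      (measurable_of_finite _).aestronglyMeasurable, integral_fintype .of_finite,
      Fintype.sum_prod_type]
    refine Finset.sum_congr rfl fun a _ => ?_
    rw [Finset.mul_sum]
    refine Finset.sum_congr rfl fun y _ => ?_
    rw [map_measureReal_apply hXY (measurableSet_singleton _), ← mul_assoc, smul_eq_mul]
    congr 1
    rw [cpmf, cpr, cpr, ← cond_cond_eq_cond_inter hA (hset a), ← ENNReal.toReal_mul, mul_comm,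
      cond_mul_eq_inter (hset a), measureReal_def]
    congr 2
    ext ω
    simp
  have hint (g : 𝒳i → 𝒴 → ℝ) :
      Integrable (fun ω => g (Xi ω) (Y ω)) ((ℙ : Measure Ω)[|A]) :=
    (Integrable.of_finite (f := fun p : 𝒳i × 𝒴 => g p.1 p.2)).comp_measurable hXY
  rw [integral_sub (hint fun _ y => xent (cpmf Y A) y)
    (hint fun a y => xent (cpmf Y (A ∩ {ω' | Xi ω' = a})) y), hIntY,
    hIntXY fun a y => xent (cpmf Y (A ∩ {ω' | Xi ω' = a})) y]
  simp [cmi, entropyOn, xent]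

theorem measurableSet_evS {d : ℕ} {𝒳 : Fin d → Type} [MeasurableSpace Ω]
    [∀ i, MeasurableSpace (𝒳 i)] [∀ i, MeasurableSingletonClass (𝒳 i)]
    {X : ∀ i, Ω → 𝒳 i} (hX : ∀ i, Measurable (X i)) (S : Finset (Fin d)) (x : ∀ i, 𝒳 i) :
    MeasurableSet (evS X S x) := by
  rw [evS, show {ω | ∀ i ∈ S, X i ω = x i} = ⋂ i ∈ S, X i ⁻¹' {x i} by ext; simp]
  exact Finset.measurableSet_biInter _ fun i _ => hX i (measurableSet_singleton _)

theorem evS_congr {d : ℕ} {𝒳 : Fin d → Type} (X : ∀ i, Ω → 𝒳 i) {S : Finset (Fin d)}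
    {x x' : ∀ i, 𝒳 i} (h : ∀ i ∈ S, x i = x' i) : evS X S x = evS X S x' := by
  ext ω
  exact forall₂_congr fun i hi => by rw [h i hi]

theorem evS_insert_inter {d : ℕ} {𝒳 : Fin d → Type} (X : ∀ i, Ω → 𝒳 i) (S : Finset (Fin d))
    (x : ∀ i, 𝒳 i) (i : Fin d) (B : Set Ω) :
    evS X (insert i S) x ∩ B = evS X S x ∩ B ∩ {ω | X i ω = x i} := by
  ext ω
  simp only [evS, Finset.forall_mem_insert, Set.mem_inter_iff, Set.mem_ofPred_eq]
  tauto

/-- The selected set, the selected feature values, and the prior information. -/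
def observed {d : ℕ} {𝒳 : Fin d → Type} {𝒵 : Type} (X : ∀ i, Ω → 𝒳 i) (Z : Ω → 𝒵)
    (𝒮 : Ω → Finset (Fin d)) (ω : Ω) : Finset (Fin d) × (∀ j, Option (𝒳 j)) × 𝒵 :=
  (𝒮 ω, fun j => if j ∈ 𝒮 ω then some (X j ω) else none, Z ω)

theorem observed_preimage_singleton {d : ℕ} {𝒳 : Fin d → Type} {𝒵 : Type}
    (X : ∀ i, Ω → 𝒳 i) (Z : Ω → 𝒵) (𝒮 : Ω → Finset (Fin d)) (ω : Ω) :
    observed X Z 𝒮 ⁻¹' {observed X Z 𝒮 ω}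
      = {ω' | 𝒮 ω' = 𝒮 ω} ∩ evS X (𝒮 ω) (fun j => X j ω) ∩ {ω' | Z ω' = Z ω} := by
  ext ω'
  simp only [observed, Set.mem_preimage, Set.mem_singleton_iff, Prod.mk.injEq, evS,
    Set.mem_inter_iff, Set.mem_ofPred_eq, and_assoc, funext_iff]
  refine and_congr_right fun hs => and_congr_left fun _ => forall_congr' fun j => ?_
  by_cases hj : j ∈ 𝒮 ω <;> simp [hs, hj]

theorem map_eq_map_of_forall_fiber {𝒴 : Type} [Fintype 𝒴] [MeasurableSpace 𝒴]
    [MeasurableSingletonClass 𝒴] [MeasurableSpace Ω] {d : ℕ} {𝒳 : Fin d → Type}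
    [∀ i, Fintype (𝒳 i)] [∀ i, MeasurableSpace (𝒳 i)] [∀ i, MeasurableSingletonClass (𝒳 i)]
    {X : ∀ i, Ω → 𝒳 i} {Y : Ω → 𝒴} (hX : ∀ i, Measurable (X i)) (hY : Measurable Y)
    {μ ν : Measure Ω}
    (h : ∀ (x : ∀ j, 𝒳 j) (y : 𝒴), μ {ω | (∀ j, X j ω = x j) ∧ Y ω = y}
      = ν {ω | (∀ j, X j ω = x j) ∧ Y ω = y}) :
    μ.map (fun ω => ((fun j => X j ω), Y ω)) = ν.map (fun ω => ((fun j => X j ω), Y ω)) := by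
  have hXY : Measurable fun ω => ((fun j => X j ω), Y ω) := (measurable_pi_lambda _ hX).prodMk hY
  refine Measure.ext_of_singleton fun ⟨x, y⟩ => ?_
  rw [Measure.map_apply hXY (measurableSet_singleton _),
    Measure.map_apply hXY (measurableSet_singleton _)]
  convert h x y using 2 <;> ext ω <;> simp [funext_iff]

/-- **Theorem 2.** With prior information `Z`, the objectives for the predictor and the value
network are jointly optimized by `f*(s, x_s, z) = p(·|x_s, z)` and
`v*_i(s, x_s, z) = I(Y; X_i | X_s = x_s, Z = z)`. -/
theorem theorem2_joint_optimality_prior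
    [MeasureSpace Ω] [IsProbabilityMeasure (ℙ : Measure Ω)]
    {𝒴 : Type} [Fintype 𝒴] [MeasurableSpace 𝒴] [MeasurableSingletonClass 𝒴]
    {𝒵 : Type} [Fintype 𝒵] [MeasurableSpace 𝒵] [MeasurableSingletonClass 𝒵]
    {d : ℕ} {𝒳 : Fin d → Type} [∀ i, Fintype (𝒳 i)]
    [∀ i, MeasurableSpace (𝒳 i)] [∀ i, MeasurableSingletonClass (𝒳 i)]
    (X : ∀ i, Ω → 𝒳 i) (Y : Ω → 𝒴) (Z : Ω → 𝒵) (𝒮 : Ω → Finset (Fin d))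
    (hX : ∀ i, Measurable (X i)) (hY : Measurable Y) (hZ : Measurable Z)
    (h𝒮 : ∀ s, MeasurableSet {ω | 𝒮 ω = s})
    (hcompat : ∀ (s : Finset (Fin d)) (x : ∀ j, 𝒳 j) (z : 𝒵),
      0 < (ℙ : Measure Ω) ({ω | 𝒮 ω = s} ∩ evS X s x ∩ {ω | Z ω = z}) →
      ∀ (x' : ∀ j, 𝒳 j) (y : 𝒴),
        ((ℙ : Measure Ω)[|{ω | 𝒮 ω = s} ∩ evS X s x ∩ {ω | Z ω = z}])
            {ω | (∀ j, X j ω = x' j) ∧ Y ω = y}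
          = ((ℙ : Measure Ω)[|evS X s x ∩ {ω | Z ω = z}])
              {ω | (∀ j, X j ω = x' j) ∧ Y ω = y}) :
    -- (i) the Bayes classifier conditioning on the prior information minimizes the expected
    -- cross-entropy loss, with the convention `−log 0 = +∞`
    (∀ f : Finset (Fin d) → (∀ j, 𝒳 j) → 𝒵 → 𝒴 → ℝ,
      (∀ s x z, IsPMF (f s x z)) →
      (∀ s x x' z, (∀ j ∈ s, x j = x' j) → f s x z = f s x' z) →
      (∫⁻ ω, negLog (cpmf Y
            (evS X (𝒮 ω) (fun j => X j ω) ∩ {ω' | Z ω' = Z ω}) (Y ω)) ∂(ℙ : Measure Ω))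
        ≤ ∫⁻ ω, negLog (f (𝒮 ω) (fun j => X j ω) (Z ω) (Y ω)) ∂(ℙ : Measure Ω))
    ∧
    -- (ii) the CMI conditioning on the prior information minimizes the expected squared error
    -- against the incremental loss improvements of the Bayes classifier
    (∀ v : Finset (Fin d) → (∀ j, 𝒳 j) → 𝒵 → Fin d → ℝ,
      (∀ s x x' z, (∀ j ∈ s, x j = x' j) → v s x z = v s x' z) →
      (∫ ω, ((1 : ℝ) / d) * ∑ i,
          (cmi Y (X i) (evS X (𝒮 ω) (fun j => X j ω) ∩ {ω' | Z ω' = Z ω})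
            - (xent (cpmf Y (evS X (𝒮 ω) (fun j => X j ω) ∩ {ω' | Z ω' = Z ω})) (Y ω)
              - xent (cpmf Y
                  (evS X (insert i (𝒮 ω)) (fun j => X j ω) ∩ {ω' | Z ω' = Z ω})) (Y ω))) ^ 2
          ∂(ℙ : Measure Ω))
        ≤ ∫ ω, ((1 : ℝ) / d) * ∑ i,
            (v (𝒮 ω) (fun j => X j ω) (Z ω) i
              - (xent (cpmf Y (evS X (𝒮 ω) (fun j => X j ω) ∩ {ω' | Z ω' = Z ω})) (Y ω)
                - xent (cpmf Y
                    (evS X (insert i (𝒮 ω)) (fun j => X j ω) ∩ {ω' | Z ω' = Z ω})) (Y ω))) ^ 2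
          ∂(ℙ : Measure Ω)) := by
  classical
  let : MeasurableSpace (Finset (Fin d) × (∀ j, Option (𝒳 j)) × 𝒵) := ⊤
  have hdisc : DiscreteMeasurableSpace (Finset (Fin d) × (∀ j, Option (𝒳 j)) × 𝒵) :=
    ⟨fun _ => trivial⟩
  have hA (ω : Ω) : MeasurableSet (evS X (𝒮 ω) (fun j => X j ω) ∩ {ω' | Z ω' = Z ω}) :=
    (measurableSet_evS hX _ _).inter (hZ (measurableSet_singleton _))
  have hC (ω : Ω) : MeasurableSet (observed X Z 𝒮 ⁻¹' {observed X Z 𝒮 ω}) := by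
    rw [observed_preimage_singleton, Set.inter_assoc]
    exact (h𝒮 _).inter (hA ω)
  have hV : Measurable (observed X Z 𝒮) := measurable_to_countable hC
  have hXY : Measurable fun ω => ((fun j => X j ω), Y ω) := (measurable_pi_lambda _ hX).prodMk hY
  have hA0 (ω : Ω) (h0 : (ℙ : Measure Ω) (observed X Z 𝒮 ⁻¹' {observed X Z 𝒮 ω}) ≠ 0) :
      (ℙ : Measure Ω) (evS X (𝒮 ω) (fun j => X j ω) ∩ {ω' | Z ω' = Z ω}) ≠ 0 := by
    refine fun h => h0 (measure_mono_null ?_ h)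
    rw [observed_preimage_singleton, Set.inter_assoc]
    exact Set.inter_subset_right
  have hmap (ω : Ω) (h0 : (ℙ : Measure Ω) (observed X Z 𝒮 ⁻¹' {observed X Z 𝒮 ω}) ≠ 0) :
      ((ℙ : Measure Ω)[|observed X Z 𝒮 ⁻¹' {observed X Z 𝒮 ω}]).map
          (fun ω => ((fun j => X j ω), Y ω))
        = ((ℙ : Measure Ω)[|evS X (𝒮 ω) (fun j => X j ω) ∩ {ω' | Z ω' = Z ω}]).map
          (fun ω => ((fun j => X j ω), Y ω)) := by
    rw [observed_preimage_singleton] at h0 ⊢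
    exact map_eq_map_of_forall_fiber hX hY (hcompat _ _ _ (pos_iff_ne_zero.2 h0))
  have hcell (ω : Ω) : ∀ᵐ ω' ∂((ℙ : Measure Ω)[|observed X Z 𝒮 ⁻¹' {observed X Z 𝒮 ω}]),
      𝒮 ω' = 𝒮 ω ∧ (∀ j ∈ 𝒮 ω, X j ω' = X j ω) ∧ Z ω' = Z ω := by
    refine ae_cond_of_forall_mem (hC ω) fun ω' h' => ?_
    rw [observed_preimage_singleton] at h'
    exact ⟨h'.1.1, h'.1.2, h'.2⟩
  constructor
  · intro f hf hfS
    refine lintegral_le_of_cond_fiber hV fun ω h0 => ?_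
    have := cond_isProbabilityMeasure (hA0 ω h0)
    have htransfer (g : 𝒴 → ℝ≥0∞) :
        ∫⁻ ω', g (Y ω') ∂((ℙ : Measure Ω)[|observed X Z 𝒮 ⁻¹' {observed X Z 𝒮 ω}])
          = ∫⁻ ω', g (Y ω')
            ∂((ℙ : Measure Ω)[|evS X (𝒮 ω) (fun j => X j ω) ∩ {ω' | Z ω' = Z ω}]) := by
      have hg : Measurable fun p : (∀ j, 𝒳 j) × 𝒴 => g p.2 := measurable_of_finite _
      rw [← lintegral_map hg hXY, hmap ω h0, lintegral_map hg hXY]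
    calc _ = ∫⁻ ω', negLog (cpmf Y
            (evS X (𝒮 ω) (fun j => X j ω) ∩ {ω' | Z ω' = Z ω}) (Y ω'))
            ∂((ℙ : Measure Ω)[|observed X Z 𝒮 ⁻¹' {observed X Z 𝒮 ω}]) := by
          refine lintegral_congr_ae ?_
          filter_upwards [hcell ω] with ω' h'
          rw [h'.1, h'.2.2, evS_congr X h'.2.1]
      _ ≤ ∫⁻ ω', negLog (f (𝒮 ω) (fun j => X j ω) (Z ω) (Y ω'))
            ∂((ℙ : Measure Ω)[|observed X Z 𝒮 ⁻¹' {observed X Z 𝒮 ω}]) := by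
          rw [htransfer fun y => negLog (cpmf Y _ y), htransfer fun y => negLog (f _ _ _ y)]
          exact lintegral_negLog_measureReal_le hY (hf _ _ _)
      _ = _ := by
          refine lintegral_congr_ae ?_
          filter_upwards [hcell ω] with ω' h'
          rw [h'.1, h'.2.2, hfS _ _ _ _ h'.2.1]
  · intro v hvS
    refine integral_le_of_cond_fiber hV fun ω h0 => ?_
    have := cond_isProbabilityMeasure (hA0 ω h0)
    have := cond_isProbabilityMeasure h0
    set A := evS X (𝒮 ω) (fun j => X j ω) ∩ {ω' | Z ω' = Z ω} with hAdef
    set ν := (ℙ : Measure Ω)[|observed X Z 𝒮 ⁻¹' {observed X Z 𝒮 ω}]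
    let δ (i : Fin d) (p : (∀ j, 𝒳 j) × 𝒴) : ℝ :=
      xent (cpmf Y A) p.2 - xent (cpmf Y (A ∩ {ω' | X i ω' = p.1 i})) p.2
    let D (i : Fin d) (ω' : Ω) : ℝ := δ i ((fun j => X j ω'), Y ω')
    have hAcell : ∀ᵐ ω' ∂ν,
        evS X (𝒮 ω') (fun j => X j ω') ∩ {ω'' | Z ω'' = Z ω'} = A := by
      filter_upwards [hcell ω] with ω' h'
      rw [h'.1, h'.2.2, evS_congr X h'.2.1]
    have hmean (i : Fin d) : ν[D i] = cmi Y (X i) A := by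
      have hδ : Measurable (δ i) := measurable_of_finite _
      rw [← integral_xent_sub_eq_cmi hY (hX i) (hA ω) (hA0 ω h0)]
      change ∫ ω', δ i ((fun j => X j ω'), Y ω') ∂ν = ∫ ω', δ i ((fun j => X j ω'), Y ω') ∂_
      rw [← integral_map hXY.aemeasurable hδ.aestronglyMeasurable, hmap ω h0,
        integral_map hXY.aemeasurable hδ.aestronglyMeasurable]
    have := Measure.isProbabilityMeasure_map (μ := ν) hXY.aemeasurable
    have hD (i : Fin d) : MemLp (D i) 2 ν :=
      (MemLp.of_discrete (f := δ i)).comp_measurePreserving ⟨hXY, rfl⟩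
    have hsq (i : Fin d) (c : ℝ) : Integrable (fun ω' => (c - D i ω') ^ 2) ν :=
      ((memLp_const c).sub (hD i)).integrable_sq
    have hint (c : Fin d → ℝ) :
        Integrable (fun ω' => ((1 : ℝ) / d) * ∑ i, (c i - D i ω') ^ 2) ν :=
      (integrable_finsetSum _ fun i _ => hsq i (c i)).const_mul _
    have hleft : (fun ω' => ((1 : ℝ) / d) * ∑ i,
          (cmi Y (X i) (evS X (𝒮 ω') (fun j => X j ω') ∩ {ω'' | Z ω'' = Z ω'})
            - (xent (cpmf Y (evS X (𝒮 ω') (fun j => X j ω') ∩ {ω'' | Z ω'' = Z ω'})) (Y ω')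
              - xent (cpmf Y
                  (evS X (insert i (𝒮 ω')) (fun j => X j ω') ∩ {ω'' | Z ω'' = Z ω'}))
                  (Y ω'))) ^ 2)
        =ᵐ[ν] fun ω' => ((1 : ℝ) / d) * ∑ i, (ν[D i] - D i ω') ^ 2 := by
      filter_upwards [hAcell] with ω' h'
      simp only [evS_insert_inter, h', hmean]
      rfl
    have hright : (fun ω' => ((1 : ℝ) / d) * ∑ i,
          (v (𝒮 ω') (fun j => X j ω') (Z ω') i
            - (xent (cpmf Y (evS X (𝒮 ω') (fun j => X j ω') ∩ {ω'' | Z ω'' = Z ω'})) (Y ω')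
              - xent (cpmf Y
                  (evS X (insert i (𝒮 ω')) (fun j => X j ω') ∩ {ω'' | Z ω'' = Z ω'}))
                  (Y ω'))) ^ 2)
        =ᵐ[ν] fun ω' => ((1 : ℝ) / d) * ∑ i,
          (v (𝒮 ω) (fun j => X j ω) (Z ω) i - D i ω') ^ 2 := by
      filter_upwards [hAcell, hcell ω] with ω' h' hc
      simp only [evS_insert_inter, h']
      rw [hc.1, hc.2.2, hvS _ _ _ _ hc.2.1]
    refine ⟨(hint _).congr hleft.symm, (hint _).congr hright.symm, ?_⟩
    rw [integral_congr_ae hleft, integral_congr_ae hright, integral_const_mul,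
      integral_const_mul, integral_finsetSum _ fun i _ => hsq i _,
      integral_finsetSum _ fun i _ => hsq i _]
    exact mul_le_mul_of_nonneg_left
      (Finset.sum_le_sum fun i _ => integral_mean_sub_sq_le (hD i) _) (by positivity)
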